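/- Let n ≥ 1, let s₁ and s₂ be nonzero real numbers with s₁·s₂ > 0, and let Q : ℂⁿ → ℝ be a nonzero real polynomial, i.e., Q(z) = Σ_{(α,β)} c_{αβ} z^α · conj(z)^β, a finite real-valued sum not identically zero. Suppose that for some k ∈ ℕ, signs ε₁,…,ε_k ∈ {+1,−1}, and holomorphic polynomials P₁,…,P_k : ℂⁿ → ℂ, one has Q(z)·(‖z‖²+s₁)·(‖z‖²+s₂) = Σ_{j=1}^{k} ε_j·|P_j(z)|² for all z ∈ ℂⁿ. Then k ≥ (n+2 choose 2). -/

import Mathlib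

noncomputable section

open scoped BigOperators

/-- Evaluation of a polynomial in `z` and `z̄`: the variables `Sum.inl i` evaluate to
`zᵢ` and the variables `Sum.inr i` evaluate to `conj zᵢ`. -/
def evalZZbar {n : ℕ} (Q : MvPolynomial (Fin n ⊕ Fin n) ℂ)
    (z : EuclideanSpace ℂ (Fin n)) : ℂ :=
  MvPolynomial.eval (Sum.elim (fun i => z i) (fun i => (starRingEnd ℂ) (z i))) Q

section SparseRecurrence

variable {R : Type*} [CommRing R] [IsDomain R]

/-- Multiplying a nonzero finitely supported sequence by `(aX + L)(bX + L)` produces at least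
three nonzero terms: the lowest one is `L²` times a nonzero element, and some intermediate one is
divisible by `L`. The elements `h l` are the complete homogeneous symmetric polynomials in
`a, b`. -/
theorem exists_three_ne_zero_terms {a b L : R} (hab : a * b ≠ 0) (hL : L ≠ 0) {h : ℕ → R}
    (hunit : ∀ l, IsUnit (h l)) (h0 : h 0 = 1) (h1 : h 1 = a + b)
    (hrec : ∀ l, h (l + 2) = (a + b) * h (l + 1) - a * b * h l)
    {f c : ℤ → R} (hc : ∀ k, c k = a * b * f (k - 2) + (a + b) * L * f (k - 1) + L ^ 2 * f k)
    (s : Finset ℤ) (hs : ∀ k, k ∈ s ↔ f k ≠ 0) (hne : s.Nonempty) :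
    ∃ i j k, i < j ∧ j < k ∧ f i ≠ 0 ∧ c i = L ^ 2 * f i ∧ L ∣ c j ∧ c j ≠ 0 ∧ c k ≠ 0 := by
  set i := s.min' hne with hi
  set m := s.max' hne with hm
  have hlow : ∀ k < i, f k = 0 := fun k hk => by
    by_contra hk'
    exact absurd (s.min'_le k ((hs k).2 hk')) (not_le.2 hk)
  have hhigh : ∀ k, m < k → f k = 0 := fun k hk => by
    by_contra hk'
    exact absurd (s.le_max' k ((hs k).2 hk')) (not_le.2 hk)
  have hfi : f i ≠ 0 := (hs i).1 (s.min'_mem hne)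
  have hfm : f m ≠ 0 := (hs m).1 (s.max'_mem hne)
  have him : i ≤ m := s.min'_le_max' hne
  have hcm : c (m + 2) = a * b * f m := by
    rw [hc, hhigh (m + 2) (by omega), hhigh (m + 2 - 1) (by omega)]
    simp
  by_contra hcon
  have hmid : ∀ j, i < j → j < m + 2 → L ∣ c j → c j = 0 := by
    intro j hij hjm hdvd
    by_contra hj
    refine hcon ⟨i, j, m + 2, hij, hjm, hfi, ?_, hdvd, hj, ?_⟩
    · rw [hc, hlow (i - 1) (by omega), hlow (i - 2) (by omega)]
      simp
    · rw [hcm]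
      exact mul_ne_zero hab hfm
  have key : ∀ l : ℕ, i + l ≤ m → L * f (i + l + 1) * h l = - (h (l + 1) * f (i + l)) := by
    intro l
    induction l with
    | zero =>
      intro _
      have e : c (i + 1) = L * ((a + b) * f i + L * f (i + 1)) := by
        rw [hc, hlow (i + 1 - 2) (by omega), show i + 1 - 1 = i by ring]
        ring
      have e0 := hmid (i + 1) (by omega) (by omega) ⟨_, e⟩
      rw [e] at e0
      have := (mul_eq_zero.1 e0).resolve_left hL
      simp only [Nat.cast_zero, add_zero, h0, zero_add, h1]
      linear_combination this
    | succ l ih =>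
      intro hl
      push_cast at hl ⊢
      have ih := ih (by omega)
      have hdvd : L ∣ f (i + l) := by
        rw [← (hunit (l + 1)).dvd_mul_left]
        exact ⟨-(f (i + l + 1) * h l), by linear_combination ih⟩
      have e : c (i + l + 2) = a * b * f (i + l) +
          L * ((a + b) * f (i + l + 1) + L * f (i + l + 2)) := by
        rw [hc, show i + (l : ℤ) + 2 - 2 = i + l by ring,
          show i + (l : ℤ) + 2 - 1 = i + l + 1 by ring]
        ring
      have e0 := hmid (i + l + 2) (by omega) (by omega)
        (e ▸ dvd_add (hdvd.mul_left _) (dvd_mul_right _ _))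
      rw [e] at e0
      rw [show i + ((l : ℤ) + 1) + 1 = i + l + 2 by ring, ← add_assoc i (l : ℤ) 1]
      refine mul_left_cancel₀ hL ?_
      rw [hrec]
      linear_combination h (l + 1) * e0 - a * b * ih
  have hend := key (m - i).toNat (by omega)
  rw [show i + ((m - i).toNat : ℤ) = m by omega, hhigh (m + 1) (by omega)] at hend
  simp only [mul_zero, zero_mul, zero_eq_neg] at hend
  exact mul_ne_zero (hunit _).ne_zero hfm hend

end SparseRecurrence

namespace MvPolynomial

section Slice

variable {K σ τ G : Type*} [CommRing K] [AddCommGroup G] [DecidableEq G]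

/-- The weight-`d` part of a polynomial for the grading `w`, with exponents pushed forward
along `π`. -/
def slice (π : (τ →₀ ℕ) →+ (σ →₀ ℕ)) (w : (τ →₀ ℕ) →+ G) (d : G) :
    MvPolynomial τ K →ₗ[K] MvPolynomial σ K :=
  (basisMonomials τ K).constr K fun m => if w m = d then monomial (π m) 1 else 0

variable (π : (τ →₀ ℕ) →+ (σ →₀ ℕ)) (w : (τ →₀ ℕ) →+ G)

theorem slice_monomial (d : G) (m : τ →₀ ℕ) (c : K) :
    slice π w d (monomial m c) = if w m = d then monomial (π m) c else 0 := by
  have h : monomial m c = c • basisMonomials τ K m := by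
    simp [coe_basisMonomials, smul_monomial]
  rw [h, map_smul, slice, Module.Basis.constr_basis]
  split_ifs <;> simp [smul_monomial]

theorem slice_mul_monomial (d : G) (p : MvPolynomial τ K) (m : τ →₀ ℕ) (c : K) :
    slice π w d (p * monomial m c) = slice π w (d - w m) p * monomial (π m) c := by
  induction p using MvPolynomial.induction_on' with
  | monomial u a =>
    simp only [monomial_mul, slice_monomial, map_add, eq_sub_iff_add_eq]
    split_ifs <;> simp [monomial_mul]
  | add p q hp hq => rw [add_mul, map_add, hp, hq, map_add, add_mul]

theorem slice_mul_C (d : G) (p : MvPolynomial τ K) (c : K) :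
    slice π w d (p * C c) = slice π w d p * C c := by
  simpa using slice_mul_monomial π w d p 0 c

theorem exists_mem_support_of_mem_support_slice {d : G} {p : MvPolynomial τ K} {β : σ →₀ ℕ}
    (hβ : β ∈ (slice π w d p).support) : ∃ m ∈ p.support, w m = d ∧ π m = β := by
  classical
  rw [p.as_sum, map_sum, mem_support_iff, coeff_sum] at hβ
  obtain ⟨m, hm, hne⟩ := Finset.exists_ne_zero_of_sum_ne_zero hβ
  rw [slice_monomial] at hne
  split_ifs at hne with hw
  · rw [coeff_monomial] at hne
    exact ⟨m, hm, hw, by by_contra h; simp [h] at hne⟩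
  · simp at hne

theorem coeff_slice (hinj : ∀ m m', w m = w m' → π m = π m' → m = m') (m : τ →₀ ℕ)
    (p : MvPolynomial τ K) : coeff (π m) (slice π w (w m) p) = coeff m p := by
  classical
  induction p using MvPolynomial.induction_on' with
  | monomial u a =>
    rw [slice_monomial, coeff_monomial]
    split_ifs with h1 h2 h2
    · rw [h2, coeff_monomial, if_pos rfl]
    · rw [coeff_monomial, if_neg fun h => h2 (hinj _ _ h1 h)]
    · exact absurd (h2 ▸ rfl) h1
    · simp
  | add p q hp hq => rw [map_add, coeff_add, hp, hq, coeff_add]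

theorem slice_ne_zero_iff (hinj : ∀ m m', w m = w m' → π m = π m' → m = m') (d : G)
    (p : MvPolynomial τ K) : d ∈ p.support.image w ↔ slice π w d p ≠ 0 := by
  rw [Finset.mem_image]
  constructor
  · rintro ⟨m, hm, rfl⟩ h
    rw [mem_support_iff, ← coeff_slice π w hinj, h] at hm
    simp at hm
  · intro h
    obtain ⟨β, hβ⟩ := support_nonempty.2 h
    obtain ⟨m, hm, hw, -⟩ := exists_mem_support_of_mem_support_slice π w hβ
    exact ⟨m, hm, hw⟩

theorem sum_card_support_slice_le (p : MvPolynomial τ K) (s : Finset G) :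
    ∑ d ∈ s, (slice π w d p).support.card ≤ p.support.card := by
  classical
  rw [← Finset.card_sigma]
  refine Finset.card_le_card_of_surjOn (t := s.sigma fun d => (slice π w d p).support)
    (fun m => (⟨w m, π m⟩ : Σ _ : G, (σ →₀ ℕ))) ?_
  rintro ⟨d, β⟩ hβ
  rw [Finset.mem_coe, Finset.mem_sigma] at hβ
  obtain ⟨m, hm, hw, hπ⟩ := exists_mem_support_of_mem_support_slice π w hβ.2
  exact ⟨m, hm, by subst hw hπ; rfl⟩

end Slice

section Count

variable {K : Type*} [Field K]

theorem card_le_card_support_mul_sum_X {σ : Type*} [Fintype σ] {g : MvPolynomial σ K}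
    (hg : g ≠ 0) : Fintype.card σ ≤ (g * ∑ i, X i).support.card := by
  classical
  choose α hα hmax using fun i : σ =>
    g.support.exists_max_image (fun m => m i) (support_nonempty.2 hg)
  rw [← Finset.card_univ]
  refine Finset.card_le_card_of_injOn (fun i => α i + Finsupp.single i 1) ?_ ?_
  · intro i _
    rw [Finset.mem_coe, mem_support_iff, Finset.mul_sum, coeff_sum,
      Finset.sum_eq_single_of_mem i (Finset.mem_univ i), coeff_mul_X]
    · exact mem_support_iff.1 (hα i)
    · intro j _ hj
      rw [coeff_mul_X']
      split_ifs with h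
      · by_contra hne
        have := hmax i _ (mem_support_iff.2 hne)
        simp [hj] at this
      · rfl
  · intro i _ j _ hij
    by_contra hne
    have h1 := DFunLike.congr_fun hij i
    have h2 := hmax i _ (hα j)
    have hne' : ¬ j = i := fun h => hne h.symm
    simp [hne'] at h1
    omega

theorem card_support_ge_of_slices {σ τ : Type*} (π : (τ →₀ ℕ) →+ (σ →₀ ℕ))
    (w : (τ →₀ ℕ) →+ ℤ) (hinj : ∀ m m', w m = w m' → π m = π m' → m = m')
    {a b : K} (hab : a * b ≠ 0) {h : ℕ → K} (hh : ∀ l, h l ≠ 0) (h0 : h 0 = 1)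
    (h1 : h 1 = a + b) (hrec : ∀ l, h (l + 2) = (a + b) * h (l + 1) - a * b * h l)
    {L : MvPolynomial σ K} (hL : L ≠ 0) {q F : MvPolynomial τ K} (hq : q ≠ 0) (N : ℤ)
    (hF : ∀ k, slice π w (k + N) F = C a * C b * slice π w (k - 2) q +
      (C a + C b) * L * slice π w (k - 1) q + L ^ 2 * slice π w k q)
    {A B : ℕ} (hA : ∀ g : MvPolynomial σ K, g ≠ 0 → A ≤ (g * L ^ 2).support.card)
    (hB : ∀ g : MvPolynomial σ K, g ≠ 0 → B ≤ (g * L).support.card) :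
    A + B + 1 ≤ F.support.card := by
  have hab' : (C a * C b : MvPolynomial σ K) ≠ 0 := by
    rw [← C_mul]
    exact (map_ne_zero_iff _ (C_injective σ K)).2 hab
  have hh' : ∀ l, IsUnit (C (h l) : MvPolynomial σ K) := fun l => (IsUnit.mk0 _ (hh l)).map C
  have h0' : (C (h 0) : MvPolynomial σ K) = 1 := by rw [h0, C_1]
  have h1' : (C (h 1) : MvPolynomial σ K) = C a + C b := by rw [h1, C_add]
  have hrec' : ∀ l, (C (h (l + 2)) : MvPolynomial σ K) =
      (C a + C b) * C (h (l + 1)) - C a * C b * C (h l) := fun l => by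
    rw [hrec, C_sub, C_mul, C_mul, C_add, C_mul]
  obtain ⟨i, j, k, hij, hjk, hfi, hci, ⟨g, hg⟩, hcj, hck⟩ :=
    exists_three_ne_zero_terms (h := fun l => C (h l)) (f := fun k => slice π w k q)
      (c := fun k => slice π w (k + N) F) hab' hL hh' h0' h1' hrec' hF (q.support.image w)
      (fun k => slice_ne_zero_iff π w hinj k q) ((support_nonempty.2 hq).image w)
  have hg0 : g ≠ 0 := by
    rintro rfl
    exact hcj (by simpa using hg)
  have hsum := sum_card_support_slice_le π w F {i + N, j + N, k + N}
  rw [Finset.sum_insert (by simp; omega), Finset.sum_pair (by omega)] at hsum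
  have e1 := hA _ hfi
  have e2 := hB _ hg0
  rw [mul_comm, ← hci] at e1
  rw [mul_comm, ← hg] at e2
  have e3 := Finset.card_pos.2 (support_nonempty.2 hck)
  omega

variable [CharZero K]

theorem choose_le_card_support_mul_sum_X_sq (n : ℕ) (q : MvPolynomial (Fin n) K) (hq : q ≠ 0) :
    (n + 1).choose 2 ≤ (q * (∑ i, X i) ^ 2).support.card := by
  induction n with
  | zero => simp
  | succ n ih =>
    rcases Nat.eq_zero_or_pos n with rfl | hn
    · refine Finset.card_pos.2 (support_nonempty.2 (mul_ne_zero hq (pow_ne_zero _ ?_)))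
      simp
    let π : (Fin (n + 1) →₀ ℕ) →+ (Fin n →₀ ℕ) :=
      Finsupp.comapDomain.addMonoidHom (Fin.succ_injective n)
    let w : (Fin (n + 1) →₀ ℕ) →+ ℤ := (Nat.castAddMonoidHom ℤ).comp (Finsupp.applyAddHom 0)
    have hπ : ∀ m i, π m i = m i.succ := fun _ _ => rfl
    have hw : ∀ m, w m = m 0 := fun _ => rfl
    have hinj : ∀ m m', w m = w m' → π m = π m' → m = m' := by
      intro m m' h1 h2
      ext i
      refine Fin.cases ?_ (fun i => ?_) i
      · rw [hw, hw] at h1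
        exact_mod_cast h1
      · exact DFunLike.congr_fun h2 i
    have hX : ∀ k (p : MvPolynomial (Fin (n + 1)) K), slice π w k (p * ∑ i, X i) =
        slice π w (k - 1) p + (∑ i, X i) * slice π w k p := by
      intro k p
      have hπ0 : π (Finsupp.single 0 1) = 0 := by
        ext i
        simp [hπ]
      have hπs : ∀ i : Fin n, π (Finsupp.single i.succ 1) = Finsupp.single i 1 := by
        intro i
        ext j
        simp [hπ, Finsupp.single_apply]
      rw [Fin.sum_univ_succ, mul_add, map_add, X, slice_mul_monomial, hπ0, hw, Finset.mul_sum,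
        map_sum, Finset.sum_mul]
      congr 1
      · simp
      · refine Finset.sum_congr rfl fun i _ => ?_
        rw [X, slice_mul_monomial, hπs, hw, mul_comm]
        simp [X]
    have hL : (∑ i, X i : MvPolynomial (Fin n) K) ≠ 0 := by
      intro h
      have := card_le_card_support_mul_sum_X (σ := Fin n) (K := K) one_ne_zero
      simp [h] at this
      omega
    have := card_support_ge_of_slices π w hinj (a := (1 : K)) (b := 1) (by simp)
      (h := fun l => (l : K) + 1) (fun l => Nat.cast_add_one_ne_zero l) (by simp)
      (by norm_num) (fun l => by push_cast; ring) hL hq (F := q * (∑ i, X i) ^ 2) 0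
      (fun k => by
        rw [pow_two, ← mul_assoc, hX, hX, hX, C_1, show k + 0 - 1 - 1 = k - 2 by ring, add_zero]
        ring)
      ih (B := n) (fun g hg => by simpa using card_le_card_support_mul_sum_X hg)
    rw [Nat.choose_succ_succ' (n + 1) 1, Nat.choose_one_right, one_add_one_eq_two]
    omega

theorem choose_le_card_support_mul_mul {n : ℕ} (hn : 1 ≤ n) {a b : K} (hab : a * b ≠ 0)
    {h : ℕ → K} (hh : ∀ l, h l ≠ 0) (h0 : h 0 = 1) (h1 : h 1 = a + b)
    (hrec : ∀ l, h (l + 2) = (a + b) * h (l + 1) - a * b * h l)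
    {q : MvPolynomial (Fin n) K} (hq : q ≠ 0) :
    (n + 2).choose 2 ≤ (q * ((∑ i, X i) + C a) * ((∑ i, X i) + C b)).support.card := by
  let w : (Fin n →₀ ℕ) →+ ℤ := -(Nat.castAddMonoidHom ℤ).comp Finsupp.degree
  have hw : ∀ m, w m = -(m.degree : ℤ) := fun _ => rfl
  have hX : ∀ k s (p : MvPolynomial (Fin n) K), slice (.id _) w k (p * ((∑ i, X i) + C s)) =
      (∑ i, X i) * slice (.id _) w (k + 1) p + C s * slice (.id _) w k p := by
    intro k s p
    rw [mul_add, map_add, slice_mul_C, Finset.mul_sum, map_sum, Finset.sum_mul, mul_comm (C s)]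
    congr 1
    refine Finset.sum_congr rfl fun i _ => ?_
    rw [X, slice_mul_monomial, hw, mul_comm]
    simp
  have hL : (∑ i, X i : MvPolynomial (Fin n) K) ≠ 0 := by
    intro h
    have := card_le_card_support_mul_sum_X (σ := Fin n) (K := K) one_ne_zero
    simp [h] at this
    omega
  have := card_support_ge_of_slices (.id _) w (fun m m' _ h => h) hab hh h0 h1 hrec hL hq
    (F := q * ((∑ i, X i) + C a) * ((∑ i, X i) + C b)) (-2)
    (fun k => by
      rw [hX, hX, hX, show k + -2 + 1 + 1 = k by ring, show k + -2 + 1 = k - 1 by ring,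
        ← sub_eq_add_neg]
      ring)
    (choose_le_card_support_mul_sum_X_sq n) (B := n)
    (fun g hg => by simpa using card_le_card_support_mul_sum_X hg)
  rw [Nat.choose_succ_succ' (n + 1) 1, Nat.choose_one_right, one_add_one_eq_two]
  omega

end Count

section Rank

theorem card_le_of_triangular_factorization {ι Γ K : Type*} [Fintype ι] [LinearOrder Γ] [Field K]
    {b : ι → Γ} (hb : Function.Injective b) {k : ℕ} {u : Matrix ι (Fin k) K}
    {v : Matrix (Fin k) ι K} (hdiag : ∀ i, (u * v) i i ≠ 0)
    (htri : ∀ i j, b j < b i → (u * v) i j = 0) : Fintype.card ι ≤ k := by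
  classical
  let := LinearOrder.lift' b hb
  have hdet : (u * v).det ≠ 0 := by
    rw [Matrix.det_of_isUpperTriangular fun i j hij => htri i j hij]
    exact Finset.prod_ne_zero_iff.2 fun i _ => hdiag i
  rw [← Matrix.rank_of_isUnit _ ((Matrix.isUnit_iff_isUnit_det _).2 (isUnit_iff_ne_zero.2 hdet))]
  calc (u * v).rank ≤ u.rank := Matrix.rank_mul_le_left _ _
    _ ≤ k := by simpa using Matrix.rank_le_card_width u

theorem coeff_rename_inl_mul_rename_inr {α β K : Type*} [CommRing K] (p : MvPolynomial α K)
    (q : MvPolynomial β K) (a : α →₀ ℕ) (b : β →₀ ℕ) :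
    coeff (Finsupp.sumElim a b) (rename Sum.inl p * rename Sum.inr q) = coeff a p * coeff b q := by
  classical
  induction p using MvPolynomial.induction_on' with
  | add p p' hp hp' => rw [map_add, add_mul, coeff_add, hp, hp', coeff_add, add_mul]
  | monomial u c =>
    induction q using MvPolynomial.induction_on' with
    | add q q' hq hq' => rw [map_add, mul_add, coeff_add, hq, hq', coeff_add, mul_add]
    | monomial v d =>
      have hmap : Finsupp.mapDomain Sum.inl u + Finsupp.mapDomain Sum.inr v =
          Finsupp.sumElim u v := by
        ext (i | i)
        · simp [Finsupp.mapDomain_apply Sum.inl_injective, Finsupp.mapDomain_of_notMem_range]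
        · simp [Finsupp.mapDomain_apply Sum.inr_injective, Finsupp.mapDomain_of_notMem_range]
      have hiff : Finsupp.sumElim u v = Finsupp.sumElim a b ↔ u = a ∧ v = b := by
        simp only [DFunLike.ext_iff, Sum.forall, Finsupp.sumElim_inl, Finsupp.sumElim_inr]
      rw [rename_monomial, rename_monomial, monomial_mul, hmap, coeff_monomial, coeff_monomial,
        coeff_monomial]
      simp only [hiff]
      split_ifs <;> simp_all

/-- The exponent of `z` in a monomial in `z` and `z̄`. -/
def leftExponent (n : ℕ) : (Fin n ⊕ Fin n →₀ ℕ) →+ (Fin n →₀ ℕ) :=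
  Finsupp.comapDomain.addMonoidHom Sum.inl_injective

/-- The exponent of `z` minus the exponent of `z̄`, ordered lexicographically. -/
def exponentDiff (n : ℕ) : (Fin n ⊕ Fin n →₀ ℕ) →+ Lex (Fin n → ℤ) where
  toFun m := toLex fun i => (m (Sum.inl i) : ℤ) - m (Sum.inr i)
  map_zero' := by
    refine _root_.funext fun i => ?_
    change ((0 : ℕ) : ℤ) - (0 : ℕ) = 0
    simp
  map_add' m m' := by
    refine _root_.funext fun i => ?_
    change ((m + m') (Sum.inl i) : ℤ) - (m + m') (Sum.inr i) =
      (m (Sum.inl i) - m (Sum.inr i)) + (m' (Sum.inl i) - m' (Sum.inr i))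
    push_cast [Finsupp.add_apply]
    ring

theorem leftExponent_apply {n : ℕ} (m : Fin n ⊕ Fin n →₀ ℕ) (i : Fin n) :
    leftExponent n m i = m (Sum.inl i) := rfl

theorem exponentDiff_leftExponent_injective {n : ℕ} (m m' : Fin n ⊕ Fin n →₀ ℕ)
    (hd : exponentDiff n m = exponentDiff n m') (hl : leftExponent n m = leftExponent n m') :
    m = m' := by
  have h1 : ∀ i, m (Sum.inl i) = m' (Sum.inl i) := fun i => DFunLike.congr_fun hl i
  ext (i | i)
  · exact h1 i
  · have h2 : (m (Sum.inl i) : ℤ) - m (Sum.inr i) = m' (Sum.inl i) - m' (Sum.inr i) :=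
      congrFun hd i
    rw [h1] at h2
    omega

theorem card_support_slice_le_rank {n k : ℕ} {K : Type*} [Field K]
    {F : MvPolynomial (Fin n ⊕ Fin n) K} {u v : Fin k → MvPolynomial (Fin n) K}
    (hF : F = ∑ j, rename Sum.inl (u j) * rename Sum.inr (v j)) (d : Lex (Fin n → ℤ))
    (hd : ∀ d', d < d' → slice (leftExponent n) (exponentDiff n) d' F = 0) :
    (slice (leftExponent n) (exponentDiff n) d F).support.card ≤ k := by
  set S := (slice (leftExponent n) (exponentDiff n) d F).support
  choose m hmF hmd hml using fun β : S =>
    exists_mem_support_of_mem_support_slice (leftExponent n) (exponentDiff n) β.2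
  let r : S → (Fin n →₀ ℕ) := fun β => (m β).comapDomain Sum.inr Sum.inr_injective.injOn
  let U : Matrix S (Fin k) K := fun β j => coeff β.1 (u j)
  let V : Matrix (Fin k) S K := fun j β => coeff (r β) (v j)
  have hUV : ∀ β β', (U * V) β β' = coeff (Finsupp.sumElim β.1 (r β')) F := by
    intro β β'
    rw [hF, coeff_sum, Matrix.mul_apply]
    exact Finset.sum_congr rfl fun j _ => (coeff_rename_inl_mul_rename_inr _ _ _ _).symm
  have hm : ∀ β, Finsupp.sumElim β.1 (r β) = m β := by
    intro β
    ext (i | i)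
    · rw [Finsupp.sumElim_inl, ← hml, leftExponent_apply]
    · rfl
  let b : S → Lex (Fin n → ℤ) := fun β => toLex fun i => (β.1 i : ℤ)
  have hb : Function.Injective b := by
    intro β β' h
    refine Subtype.ext (Finsupp.ext fun i => ?_)
    have : (β.1 i : ℤ) = β'.1 i := congrFun h i
    exact_mod_cast this
  rw [← Fintype.card_coe]
  refine card_le_of_triangular_factorization hb (u := U) (v := V) (fun β => ?_) fun β β' h => ?_
  · rw [hUV, hm]
    exact mem_support_iff.1 (hmF β)
  · rw [hUV]
    by_contra hne
    refine (slice_ne_zero_iff (leftExponent n) (exponentDiff n)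
      exponentDiff_leftExponent_injective _ F).1
      (Finset.mem_image_of_mem _ (mem_support_iff.2 hne)) (hd _ ?_)
    have hdiff : exponentDiff n (Finsupp.sumElim β.1 (r β')) = d + (b β - b β') := by
      rw [← hmd β', ← hm β']
      refine _root_.funext fun i => ?_
      change (β.1 i : ℤ) - r β' i = (β'.1 i - r β' i) + (β.1 i - β'.1 i)
      ring
    rw [hdiff]
    exact lt_add_of_pos_right _ (sub_pos.2 h)

theorem slice_mul_sum_X_mul_X {n : ℕ} {K : Type*} [CommRing K] (d : Lex (Fin n → ℤ)) (s : K)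
    (p : MvPolynomial (Fin n ⊕ Fin n) K) :
    slice (leftExponent n) (exponentDiff n) d
        (p * ((∑ i, X (Sum.inl i) * X (Sum.inr i)) + C s)) =
      slice (leftExponent n) (exponentDiff n) d p * ((∑ i, X i) + C s) := by
  rw [mul_add, map_add, slice_mul_C, mul_add, Finset.mul_sum, map_sum, Finset.mul_sum]
  congr 1
  refine Finset.sum_congr rfl fun i _ => ?_
  have hd : exponentDiff n (Finsupp.single (Sum.inl i) 1 + Finsupp.single (Sum.inr i) 1) = 0 := by
    refine _root_.funext fun j => ?_
    change (((Finsupp.single (Sum.inl i) 1 + Finsupp.single (Sum.inr i) 1 :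
      Fin n ⊕ Fin n →₀ ℕ) (Sum.inl j) : ℕ) : ℤ) - ((Finsupp.single (Sum.inl i) 1 +
      Finsupp.single (Sum.inr i) 1 : Fin n ⊕ Fin n →₀ ℕ) (Sum.inr j) : ℕ) = 0
    simp [Finsupp.single_apply]
  have hl : leftExponent n (Finsupp.single (Sum.inl i) 1 + Finsupp.single (Sum.inr i) 1) =
      Finsupp.single i 1 := by
    ext j
    rw [leftExponent_apply]
    simp [Finsupp.single_apply]
  rw [X, X, monomial_mul, slice_mul_monomial, hd, hl, sub_zero, mul_one, X]

theorem eq_zero_of_eval_conj_eq_zero {n : ℕ} {F : MvPolynomial (Fin n ⊕ Fin n) ℂ}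
    (hF : ∀ z : Fin n → ℂ, eval (Sum.elim z fun i => (starRingEnd ℂ) (z i)) F = 0) : F = 0 := by
  let G : MvPolynomial (Fin n ⊕ Fin n) ℂ := bind₁ (Sum.elim
    (fun i => X (Sum.inl i) + C Complex.I * X (Sum.inr i))
    (fun i => X (Sum.inl i) - C Complex.I * X (Sum.inr i))) F
  have hG : ∀ x : Fin n ⊕ Fin n → ℂ, eval x G = eval (Sum.elim
      (fun i => x (Sum.inl i) + Complex.I * x (Sum.inr i))
      (fun i => x (Sum.inl i) - Complex.I * x (Sum.inr i))) F := by
    intro x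
    rw [show eval x G = eval₂Hom (RingHom.id ℂ) x G from rfl, eval₂Hom_bind₁]
    refine congrArg (fun y => eval y F) ?_
    ext (i | i) <;> simp
  have hG0 : G = 0 := by
    refine funext_set (fun _ => Set.range ((↑) : ℝ → ℂ))
      (fun _ => Set.infinite_range_of_injective Complex.ofReal_injective) fun x hx => ?_
    rw [map_zero, hG, ← hF fun i => x (Sum.inl i) + Complex.I * x (Sum.inr i)]
    refine congrArg (fun y => eval y F) ?_
    ext (i | i)
    · rfl
    · obtain ⟨s, hs⟩ := hx (Sum.inl i) trivial
      obtain ⟨t, ht⟩ := hx (Sum.inr i) trivial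
      simp [← hs, ← ht, sub_eq_add_neg]
  refine funext fun x => ?_
  have h := hG (Sum.elim (fun i => (x (Sum.inl i) + x (Sum.inr i)) / 2)
    (fun i => (x (Sum.inl i) - x (Sum.inr i)) / (2 * Complex.I)))
  rw [hG0, map_zero] at h
  rw [map_zero, h]
  refine congrArg (fun y => eval y F) ?_
  ext (i | i) <;> simp <;> field_simp <;> ring

end Rank

end MvPolynomial

theorem MvPolynomial.choose_le_rank {n : ℕ} (hn : 1 ≤ n) {K : Type*} [Field K] [CharZero K]
    {a b : K} (hab : a * b ≠ 0) {h : ℕ → K} (hh : ∀ l, h l ≠ 0) (h0 : h 0 = 1) (h1 : h 1 = a + b)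
    (hrec : ∀ l, h (l + 2) = (a + b) * h (l + 1) - a * b * h l)
    {Q : MvPolynomial (Fin n ⊕ Fin n) K} (hQ : Q ≠ 0) {k : ℕ}
    {u v : Fin k → MvPolynomial (Fin n) K}
    (hF : Q * ((∑ i, X (Sum.inl i) * X (Sum.inr i)) + C a) *
      ((∑ i, X (Sum.inl i) * X (Sum.inr i)) + C b) =
        ∑ j, rename Sum.inl (u j) * rename Sum.inr (v j)) :
    (n + 2).choose 2 ≤ k := by
  set D := Q.support.image (exponentDiff n)
  have hD : D.Nonempty := (support_nonempty.2 hQ).image _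
  have hiff := fun d => slice_ne_zero_iff (leftExponent n) (exponentDiff n)
    exponentDiff_leftExponent_injective d Q
  have hrank := card_support_slice_le_rank hF (D.max' hD) fun d hd => by
    rw [slice_mul_sum_X_mul_X, slice_mul_sum_X_mul_X]
    have : slice (leftExponent n) (exponentDiff n) d Q = 0 := by
      by_contra hne
      exact absurd (D.le_max' d ((hiff d).2 hne)) (not_le.2 hd)
    simp [this]
  rw [slice_mul_sum_X_mul_X, slice_mul_sum_X_mul_X] at hrank
  exact (choose_le_card_support_mul_mul hn hab hh h0 h1 hrec
    ((hiff _).1 (D.max'_mem hD))).trans hrank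

/-- The complete homogeneous symmetric polynomials in two reals of the same sign do not vanish. -/
theorem exists_ne_zero_recurrence {a b : ℝ} (hab : 0 < a * b) :
    ∃ h : ℕ → ℝ, (∀ l, h l ≠ 0) ∧ h 0 = 1 ∧ h 1 = a + b ∧
      ∀ l, h (l + 2) = (a + b) * h (l + 1) - a * b * h l := by
  let h : ℕ → ℝ := fun l => Nat.rec 1 (fun l x => a ^ (l + 1) + b * x) l
  have hs : ∀ l, h (l + 1) = a ^ (l + 1) + b * h l := fun _ => rfl
  have h0 : h 0 = 1 := rfl
  have hpos : ∀ l, 0 < h l * a ^ l := by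
    intro l
    induction l with
    | zero => simp [h0]
    | succ l ih =>
      have e : h (l + 1) * a ^ (l + 1) = (a ^ (l + 1)) ^ 2 + a * b * (h l * a ^ l) := by
        rw [hs]
        ring
      rw [e]
      positivity
  refine ⟨h, fun l => left_ne_zero_of_mul (hpos l).ne', h0, ?_, fun l => ?_⟩
  · simpa [h0] using hs 0
  · rw [hs, hs]
    ring

/-- **Hermitian rank bound.** If `Q(z,z̄)` is a nonzero real polynomial on `ℂⁿ`, `s₁, s₂`
are nonzero reals of the same sign, and
`Q(z)·(‖z‖²+s₁)·(‖z‖²+s₂) = Σ_{j=1}^{k} ε_j·|P_j(z)|²` with `ε_j = ±1` and `P_j`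
holomorphic polynomials, then `k ≥ (n+2 choose 2)`. -/
theorem hermitian_rank_bound (n : ℕ) (hn : 1 ≤ n) (s1 s2 : ℝ)
    (hs1 : s1 ≠ 0) (hs2 : s2 ≠ 0) (hs : 0 < s1 * s2)
    (Q : MvPolynomial (Fin n ⊕ Fin n) ℂ)
    (hreal : ∀ z : EuclideanSpace ℂ (Fin n), (evalZZbar Q z).im = 0)
    (hQne : ∃ z : EuclideanSpace ℂ (Fin n), evalZZbar Q z ≠ 0)
    (k : ℕ) (ε : Fin k → ℝ) (hε : ∀ j, ε j = 1 ∨ ε j = -1)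
    (P : Fin k → MvPolynomial (Fin n) ℂ)
    (heq : ∀ z : EuclideanSpace ℂ (Fin n),
      (evalZZbar Q z).re * (‖z‖ ^ 2 + s1) * (‖z‖ ^ 2 + s2) =
        ∑ j, ε j * ‖MvPolynomial.eval (fun i => z i) (P j)‖ ^ 2) :
    (n + 2).choose 2 ≤ k := by
  obtain ⟨h, hh, h0, h1, hrec⟩ := exists_ne_zero_recurrence hs
  have hQ : Q ≠ 0 := by
    rintro rfl
    simp [evalZZbar] at hQne
  refine MvPolynomial.choose_le_rank hn (a := (s1 : ℂ)) (b := s2) (by exact_mod_cast hs.ne')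
    (h := fun l => (h l : ℂ)) (fun l => by exact_mod_cast hh l) (by exact_mod_cast h0)
    (by exact_mod_cast h1) (fun l => by exact_mod_cast hrec l) hQ
    (u := fun j => MvPolynomial.C (ε j : ℂ) * P j)
    (v := fun j => MvPolynomial.map (starRingEnd ℂ) (P j)) ?_
  refine sub_eq_zero.1 (MvPolynomial.eq_zero_of_eval_conj_eq_zero fun z => ?_)
  have hz := congrArg (fun x : ℝ => (x : ℂ)) (heq (WithLp.toLp 2 z))
  have hre : ((evalZZbar Q (WithLp.toLp 2 z)).re : ℂ) = evalZZbar Q (WithLp.toLp 2 z) :=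
    Complex.ext rfl (by simp [hreal])
  have hconj : ∀ p : MvPolynomial (Fin n) ℂ, MvPolynomial.eval (fun i => (starRingEnd ℂ) (z i))
      (MvPolynomial.map (starRingEnd ℂ) p) = (starRingEnd ℂ) (MvPolynomial.eval z p) := fun p => by
    rw [MvPolynomial.eval_map, ← MvPolynomial.eval₂_id, MvPolynomial.hom_eval₂]
    rfl
  simp only [EuclideanSpace.norm_sq_eq] at hz
  push_cast [hre] at hz
  simp only [← Complex.mul_conj'] at hz
  simp only [map_sub, map_mul, map_add, map_sum, MvPolynomial.eval_X, MvPolynomial.eval_C,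
    Sum.elim_inl, Sum.elim_inr, MvPolynomial.eval_rename, Sum.elim_comp_inl, MvPolynomial.rename_C]
  rw [show (Sum.elim z fun i => (starRingEnd ℂ) (z i)) ∘ Sum.inr =
    fun i => (starRingEnd ℂ) (z i) from rfl, sub_eq_zero]
  simp only [hconj, mul_assoc] at hz ⊢
  exact hz
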